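/- Let n ≥ 2 be even, let A be a unital associative algebra over a commutative unital ring R that is 2-torsion free and (n−1)-torsion free, let e be a nontrivial idempotent in A and f = 1 − e, suppose A satisfies property (Q), and let φ be a Lie n-derivation on A. Then φ is standard if and only if: (i) fφ(a)f ∈ fZ(A)f for every a ∈ eAe and eφ(b)e ∈ eZ(A)e for every b ∈ fAf; and (ii) eφ(tm)e + fφ(mt)f ∈ Z(A) for every m ∈ eAf and t ∈ fAe. -/

import Mathlib

open Finset

/-- Iterated commutator: `pCom x k = p_{k+1}(x 0, ..., x k)`, i.e.
`pCom x 0 = x 0` and `pCom x (k+1) = [pCom x k, x (k+1)]`. -/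
def pCom {A : Type*} [Ring A] (x : ℕ → A) : ℕ → A
  | 0 => x 0
  | k + 1 => pCom x k * x (k + 1) - x (k + 1) * pCom x k

/-- `φ` is a Lie `n`-derivation. -/
def IsLieNDeriv {R : Type*} {A : Type*} [CommRing R] [Ring A] [Algebra R A]
    (n : ℕ) (φ : A →ₗ[R] A) : Prop :=
  ∀ x : ℕ → A,
    φ (pCom x (n - 1)) =
      ∑ i ∈ Finset.range n, pCom (Function.update x i (φ (x i))) (n - 1)

/-- `d` is a derivation. -/
def IsDeriv {R : Type*} {A : Type*} [CommRing R] [Ring A] [Algebra R A]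
    (d : A →ₗ[R] A) : Prop :=
  ∀ x y : A, d (x * y) = d x * y + x * d y

/-- `δ` is a Jordan derivation. -/
def IsJordanDeriv {R : Type*} {A : Type*} [CommRing R] [Ring A] [Algebra R A]
    (δ : A →ₗ[R] A) : Prop :=
  ∀ x y : A, δ (x * y + y * x) = δ x * y + y * δ x + x * δ y + δ y * x

/-- `δ` is an antiderivation. -/
def IsAntiDeriv {R : Type*} {A : Type*} [CommRing R] [Ring A] [Algebra R A]
    (δ : A →ₗ[R] A) : Prop :=
  ∀ x y : A, δ (x * y) = δ y * x + y * δ x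

/-- `δ` is a singular Jordan derivation relative to the idempotent `e`
(with `f = 1 - e`): it is a Jordan derivation killing `eAe` and `fAf`,
mapping `eAf` into `fAe` and `fAe` into `eAf`. -/
def IsSingularJordanDeriv {R : Type*} {A : Type*} [CommRing R] [Ring A] [Algebra R A]
    (e : A) (δ : A →ₗ[R] A) : Prop :=
  IsJordanDeriv δ ∧
  (∀ a : A, δ (e * a * e) = 0) ∧
  (∀ b : A, δ ((1 - e) * b * (1 - e)) = 0) ∧
  (∀ m : A, δ (e * m * (1 - e)) = (1 - e) * δ (e * m * (1 - e)) * e) ∧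
  (∀ t : A, δ ((1 - e) * t * e) = e * δ ((1 - e) * t * e) * (1 - e))

/-- `z` is a central element. -/
def IsCent {A : Type*} [Ring A] (z : A) : Prop := ∀ y : A, z * y = y * z

/-- The centre of `A` as a set. -/
def centerSet (A : Type*) [Ring A] : Set A := {z : A | ∀ y : A, z * y = y * z}

/-- `γ` vanishes on all `(n-1)`-th commutators. -/
def VanishesOnNCommutators {R : Type*} {A : Type*} [CommRing R] [Ring A] [Algebra R A]
    (n : ℕ) (γ : A →ₗ[R] A) : Prop :=
  ∀ x : ℕ → A, γ (pCom x (n - 1)) = 0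

/-- A Lie `n`-derivation is standard if it is the sum of a derivation and a
central-valued map vanishing on all `(n-1)`-th commutators. -/
def IsStandardLieNDeriv {R : Type*} {A : Type*} [CommRing R] [Ring A] [Algebra R A]
    (n : ℕ) (φ : A →ₗ[R] A) : Prop :=
  ∃ d γ : A →ₗ[R] A,
    IsDeriv d ∧ (∀ x : A, IsCent (γ x)) ∧ VanishesOnNCommutators n γ ∧ φ = d + γ

/-- Property (Q) for the idempotent `e` (with `f = 1 - e`):
`exe·eAf = 0 = fAe·exe` implies `exe = 0`, and
`eAf·fxf = 0 = fxf·fAe` implies `fxf = 0`. -/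
def PropQ {A : Type*} [Ring A] (e : A) : Prop :=
  (∀ x : A,
    ((∀ y : A, (e * x * e) * (e * y * (1 - e)) = 0) ∧
     (∀ y : A, ((1 - e) * y * e) * (e * x * e) = 0)) → e * x * e = 0) ∧
  (∀ x : A,
    ((∀ y : A, (e * y * (1 - e)) * ((1 - e) * x * (1 - e)) = 0) ∧
     (∀ y : A, ((1 - e) * x * (1 - e)) * ((1 - e) * y * e) = 0)) →
        (1 - e) * x * (1 - e) = 0)

/-- `A` is `k`-torsion free. -/
def TorsionFreeAt (A : Type*) [Ring A] (k : ℕ) : Prop :=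
  ∀ x : A, k • x = 0 → x = 0

/-- The centre of the corner algebra `gAg` (for an idempotent `g`). -/
def cornerCenter {A : Type*} [Ring A] (g : A) : Set A :=
  {z : A | z = g * z * g ∧ ∀ a : A, z * (g * a * g) = (g * a * g) * z}

/-- The corner algebra `gAg` has no nonzero central ideal: every
ideal of `gAg` consisting of elements central in `gAg` is zero. -/
def NoNonzeroCentralIdeal (R : Type*) [CommRing R] (A : Type*) [Ring A] [Algebra R A]
    (g : A) : Prop :=
  ∀ I : Set A, (0 : A) ∈ I →
    (∀ x ∈ I, x = g * x * g) →
    (∀ x ∈ I, ∀ y ∈ I, x + y ∈ I) →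
    (∀ r : R, ∀ x ∈ I, r • x ∈ I) →
    (∀ x ∈ I, ∀ a : A, (g * a * g) * x ∈ I) →
    (∀ x ∈ I, ∀ a : A, x * (g * a * g) ∈ I) →
    (∀ x ∈ I, ∀ a : A, x * (g * a * g) = (g * a * g) * x) →
    ∀ x ∈ I, x = 0

/-- The generating set of `S(gAg)`: all idempotents of `gAg` together with all
commutators of elements of `gAg`. -/
def cornerGenSet {A : Type*} [Ring A] (g : A) : Set A :=
  {x : A | x = g * x * g ∧ x * x = x} ∪
  {x : A | ∃ a b : A, x = (g * a * g) * (g * b * g) - (g * b * g) * (g * a * g)}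

/-- `gAg = S(gAg)`: the corner algebra is generated (as an algebra) by its
idempotents and commutators. -/
def CornerGenerated (R : Type*) [CommRing R] {A : Type*} [Ring A] [Algebra R A]
    (g : A) : Prop :=
  ∀ x : A, g * x * g ∈ NonUnitalAlgebra.adjoin R (cornerGenSet g)

/-- Condition (*) for the corner algebra `gAg`: if `[x, gAg] ⊆ Z(gAg)` then
`x ∈ Z(gAg)`. -/
def CornerCondStar {A : Type*} [Ring A] (g : A) : Prop :=
  ∀ x : A, x = g * x * g →
    (∀ a : A, x * (g * a * g) - (g * a * g) * x ∈ cornerCenter g) →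
    x ∈ cornerCenter g

section LeibnizSum

variable {A : Type*} [Ring A]

/-- The right-hand side of the Leibniz rule for `pCom x k`, computed recursively. -/
def leibSum (φ : A → A) (x : ℕ → A) : ℕ → A
  | 0 => φ (x 0)
  | k + 1 => leibSum φ x k * x (k + 1) - x (k + 1) * leibSum φ x k +
      (pCom x k * φ (x (k + 1)) - φ (x (k + 1)) * pCom x k)

theorem pCom_congr {x y : ℕ → A} {k : ℕ} (h : ∀ i ≤ k, x i = y i) : pCom x k = pCom y k := by
  induction k with
  | zero => exact h 0 le_rfl
  | succ k ih =>
    simp only [pCom]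
    rw [ih fun i hi => h i (by omega), h (k + 1) le_rfl]

theorem sum_pCom_update (φ : A → A) (x : ℕ → A) (k : ℕ) :
    ∑ i ∈ Finset.range (k + 1), pCom (Function.update x i (φ (x i))) k = leibSum φ x k := by
  induction k with
  | zero => simp [pCom, leibSum]
  | succ k ih =>
    rw [Finset.sum_range_succ, leibSum, ← ih, Finset.sum_mul, Finset.mul_sum,
      ← Finset.sum_sub_distrib]
    congr 1
    · refine Finset.sum_congr rfl fun i hi => ?_
      have hne : k + 1 ≠ i := by have := Finset.mem_range.1 hi; omega
      simp [pCom, Function.update_of_ne hne]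
    · have h : pCom (Function.update x (k + 1) (φ (x (k + 1)))) k = pCom x k :=
        pCom_congr fun i hi => Function.update_of_ne (by omega) _ _
      simp [pCom, h]

theorem leibSum_sub (φ ψ : A → A) (x : ℕ → A) (k : ℕ) :
    leibSum (fun a => φ a - ψ a) x k = leibSum φ x k - leibSum ψ x k := by
  induction k with
  | zero => rfl
  | succ k ih =>
    simp only [leibSum, ih]
    noncomm_ring

theorem leibSum_eq_zero_of_isCent {γ : A → A} (hγ : ∀ a, IsCent (γ a)) (x : ℕ → A) (k : ℕ) :
    leibSum γ x (k + 1) = 0 := by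
  induction k with
  | zero => simp [leibSum, hγ (x 0) (x 1), hγ (x 1) (pCom x 0)]
  | succ k ih => rw [leibSum, ih, hγ (x (k + 2)) (pCom x (k + 1))]; simp

/-- Bracketing an even number of times with `e` fixes off-diagonal elements. -/
theorem pCom_add_two_mul {e : A} {x : ℕ → A} {s j : ℕ}
    (hx : ∀ i, s < i → i ≤ s + 2 * j → x i = e)
    (hp : (pCom x s * e - e * pCom x s) * e - e * (pCom x s * e - e * pCom x s) = pCom x s) :
    pCom x (s + 2 * j) = pCom x s := by
  induction j with
  | zero => rfl
  | succ j ih =>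
    have h1 : x (s + 2 * j + 1) = e := hx _ (by omega) (by omega)
    have h2 : x (s + 2 * j + 1 + 1) = e := hx _ (by omega) (by omega)
    rw [show s + 2 * (j + 1) = s + 2 * j + 1 + 1 by ring]
    simp only [pCom, h1, h2]
    rw [ih fun i hi hi' => hx i hi (by omega), hp]

theorem leibSum_add_two_mul {e : A} {φ : A → A} (hc : IsCent (φ e)) {x : ℕ → A} {s j : ℕ}
    (hx : ∀ i, s < i → i ≤ s + 2 * j → x i = e)
    (hl : (leibSum φ x s * e - e * leibSum φ x s) * e -
      e * (leibSum φ x s * e - e * leibSum φ x s) = leibSum φ x s) :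
    leibSum φ x (s + 2 * j) = leibSum φ x s := by
  induction j with
  | zero => rfl
  | succ j ih =>
    have h1 : x (s + 2 * j + 1) = e := hx _ (by omega) (by omega)
    have h2 : x (s + 2 * j + 1 + 1) = e := hx _ (by omega) (by omega)
    rw [show s + 2 * (j + 1) = s + 2 * j + 1 + 1 by ring]
    simp only [leibSum, h1, h2]
    rw [ih fun i hi hi' => hx i hi (by omega), hc, hc, sub_self, sub_self, add_zero, add_zero, hl]

theorem pCom_idempotent_odd {e y : A}
    (hy : (y * e - e * y) * e - e * (y * e - e * y) = y) (j : ℕ) :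
    pCom (fun i => if i = 0 then y else e) (2 * j + 1) = y * e - e * y := by
  have h := pCom_add_two_mul (e := e) (x := fun i => if i = 0 then y else e) (s := 0) (j := j)
    (fun i hi _ => if_neg (by omega)) (by simpa [pCom] using hy)
  rw [zero_add] at h
  simp [pCom, h]

theorem leibSum_idempotent_odd {e y : A} (he : e * e = e) {φ : A → A} (hc : φ e * e = e * φ e)
    (hy : (y * e - e * y) * e - e * (y * e - e * y) = y) (j : ℕ) :
    leibSum φ (fun i => if i = 0 then y else e) (2 * j + 1) =
      φ y * e - e * φ y + (2 * j + 1) • (y * φ e - φ e * y) := by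
  induction j with
  | zero => simp [leibSum, pCom]
  | succ j ih =>
    have hodd := pCom_idempotent_odd hy j
    have heven : pCom (fun i => if i = 0 then y else e) (2 * j + 1 + 1) = y := by
      rw [pCom, hodd]; simpa using hy
    have hcube : ((φ y * e - e * φ y) * e - e * (φ y * e - e * φ y)) * e -
        e * ((φ y * e - e * φ y) * e - e * (φ y * e - e * φ y)) = φ y * e - e * φ y := by
      have h1 : ∀ z, e * (e * z) = e * z := fun z => by rw [← mul_assoc, he]
      simp only [mul_sub, sub_mul, mul_assoc, he, h1]
      abel
    set c := φ e
    set v := y * c - c * y with hv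
    have hDv : (y * e - e * y) * c - c * (y * e - e * y) = v * e - e * v := by
      have h1 : ∀ z, c * (e * z) = e * (c * z) := fun z => by rw [← mul_assoc, hc, mul_assoc]
      simp only [hv, mul_sub, sub_mul, mul_assoc, hc, h1]
      abel
    have hDDv : (v * e - e * v) * e - e * (v * e - e * v) = v := by
      have h1 : ∀ z, c * (e * z) = e * (c * z) := fun z => by rw [← mul_assoc, hc, mul_assoc]
      have h3 : v = ((y * e - e * y) * e - e * (y * e - e * y)) * c -
        c * ((y * e - e * y) * e - e * (y * e - e * y)) := by rw [hy]
      conv_rhs => rw [h3]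
      simp only [hv, mul_sub, sub_mul, mul_assoc, hc, h1]
      abel
    rw [show 2 * (j + 1) + 1 = 2 * j + 1 + 1 + 1 by ring, leibSum, heven, leibSum, ih, hodd]
    simp only [Nat.add_eq_zero_iff, one_ne_zero, and_false, if_false]
    change _ = _ + _ • v
    rw [show φ e = c from rfl, hDv, ← hv]
    calc _ = (((φ y * e - e * φ y) * e - e * (φ y * e - e * φ y)) * e -
        e * ((φ y * e - e * φ y) * e - e * (φ y * e - e * φ y))) +
        (2 * j + 1 + 1) • ((v * e - e * v) * e - e * (v * e - e * v)) + v := by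
          generalize φ y = w
          simp only [add_smul, smul_sub, one_smul, mul_add, add_mul, mul_sub, sub_mul,
            smul_mul_assoc, mul_smul_comm]
          abel
      _ = _ := by rw [hcube, hDDv, succ_nsmul _ (2 * j + 1 + 1), add_assoc]

end LeibnizSum

section Peirce

variable {A : Type*} [Ring A]

/-- `x` lies in the Peirce block `pAq`. -/
def IsBlock (p q x : A) : Prop := p * x = x ∧ x * q = x

theorem IsBlock.mul {p q r s x y : A} (hx : IsBlock p q x) (hy : IsBlock r s y) :
    IsBlock p s (x * y) :=
  ⟨by rw [← mul_assoc, hx.1], by rw [mul_assoc, hy.2]⟩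

theorem IsBlock.mul_eq_zero {p q r s x y : A} (hx : IsBlock p q x) (hqr : q * r = 0)
    (hy : IsBlock r s y) : x * y = 0 := by
  rw [← hx.2, ← hy.1, mul_assoc, ← mul_assoc q, hqr, zero_mul, mul_zero]

theorem IsBlock.add {p q x y : A} (hx : IsBlock p q x) (hy : IsBlock p q y) :
    IsBlock p q (x + y) :=
  ⟨by rw [mul_add, hx.1, hy.1], by rw [add_mul, hx.2, hy.2]⟩

theorem IsBlock.sub {p q x y : A} (hx : IsBlock p q x) (hy : IsBlock p q y) :
    IsBlock p q (x - y) :=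
  ⟨by rw [mul_sub, hx.1, hy.1], by rw [sub_mul, hx.2, hy.2]⟩

theorem IsBlock.neg {p q x : A} (hx : IsBlock p q x) : IsBlock p q (-x) :=
  ⟨by rw [mul_neg, hx.1], by rw [neg_mul, hx.2]⟩

/-- Complementary idempotents `e`, `f` whose diagonal corners act faithfully on the
off-diagonal blocks. -/
structure FaithfulPair (e f : A) : Prop where
  left : e * e = e
  right : f * f = f
  left_right : e * f = 0
  right_left : f * e = 0
  add : e + f = 1
  faithful_left : ∀ x, IsBlock e e x → (∀ m, IsBlock e f m → x * m = 0) →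
    (∀ t, IsBlock f e t → t * x = 0) → x = 0
  faithful_right : ∀ x, IsBlock f f x → (∀ t, IsBlock f e t → x * t = 0) →
    (∀ m, IsBlock e f m → m * x = 0) → x = 0

namespace FaithfulPair

variable {e f : A}

theorem symm (h : FaithfulPair e f) : FaithfulPair f e where
  left := h.right
  right := h.left
  left_right := h.right_left
  right_left := h.left_right
  add := by rw [add_comm, h.add]
  faithful_left := h.faithful_right
  faithful_right := h.faithful_left

theorem right_eq (h : FaithfulPair e f) : f = 1 - e := by rw [← h.add]; abel

theorem of_propQ {e : A} (he : e * e = e) (hQ : PropQ e) : FaithfulPair e (1 - e) := by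
  have hff : (1 - e) * (1 - e) = 1 - e := by simp [mul_sub, sub_mul, he]
  have hef : e * (1 - e) = 0 := by simp [mul_sub, he]
  have hfe : (1 - e) * e = 0 := by simp [sub_mul, he]
  have hblock : ∀ {p q : A}, p * p = p → q * q = q → ∀ y, IsBlock p q (p * y * q) :=
    fun hp hq y => ⟨by rw [← mul_assoc, ← mul_assoc, hp], by rw [mul_assoc, hq]⟩
  refine ⟨he, hff, hef, hfe, by abel, fun x hx hm ht => ?_, fun x hx ht hm => ?_⟩
  · have h := hQ.1 x
    rw [hx.1, hx.2] at h
    exact h ⟨fun y => hm _ (hblock he hff y), fun y => ht _ (hblock hff he y)⟩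
  · have h := hQ.2 x
    rw [hx.1, hx.2] at h
    exact h ⟨fun y => hm _ (hblock he hff y), fun y => ht _ (hblock hff he y)⟩

theorem isBlock_left (h : FaithfulPair e f) (y : A) : IsBlock e e (e * y * e) :=
  ⟨by rw [← mul_assoc, ← mul_assoc, h.left], by rw [mul_assoc, h.left]⟩

theorem isBlock_left_right (h : FaithfulPair e f) (y : A) : IsBlock e f (e * y * f) :=
  ⟨by rw [← mul_assoc, ← mul_assoc, h.left], by rw [mul_assoc, h.right]⟩

theorem eq_add_blocks (h : FaithfulPair e f) (y : A) :
    y = e * y * e + e * y * f + f * y * e + f * y * f := by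
  calc y = (e + f) * y * (e + f) := by rw [h.add, one_mul, mul_one]
    _ = _ := by noncomm_ring

/-- Bracketing with `e` twice fixes off-diagonal elements. -/
theorem bracket_bracket (h : FaithfulPair e f) {y : A} (hy : IsBlock e f y ∨ IsBlock f e y) :
    (y * e - e * y) * e - e * (y * e - e * y) = y := by
  rcases hy with hy | hy
  · have h1 : y * e = 0 := hy.mul_eq_zero h.right_left ⟨h.left, h.left⟩
    simp [h1, hy.1]
  · have h1 : e * y = 0 := IsBlock.mul_eq_zero (p := e) (q := e) ⟨h.left, h.left⟩ h.left_right hy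
    simp [h1, hy.2]

theorem commute_right (h : FaithfulPair e f) {x : A} (hx : x * e = e * x) : x * f = f * x := by
  rw [h.right_eq, mul_sub, sub_mul, hx, mul_one, one_mul]

theorem isBlock_of_commute (h : FaithfulPair e f) {x : A} (hx : x * e = e * x)
    (h0 : f * x * f = 0) : IsBlock e e x := by
  have h1 : f * x = 0 := by
    rw [← h0, mul_assoc, h.commute_right hx, ← mul_assoc, h.right]
  have h2 : e * x = x := by
    calc e * x = (e + f) * x := by rw [add_mul, h1, add_zero]
      _ = x := by rw [h.add, one_mul]
  exact ⟨h2, by rw [hx, h2]⟩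

theorem mul_comm_left_corner (h : FaithfulPair e f) {x : A} (hx : x * e = e * x)
    (hm : ∀ m, IsBlock e f m → x * m = m * x) (ht : ∀ t, IsBlock f e t → x * t = t * x)
    {a : A} (ha : IsBlock e e a) : x * a = a * x := by
  refine sub_eq_zero.1 (h.faithful_left _ ⟨?_, ?_⟩ (fun m hm' => ?_) fun t ht' => ?_)
  · rw [mul_sub, ← mul_assoc, ← hx, mul_assoc, ha.1, ← mul_assoc, ha.1]
  · rw [sub_mul, mul_assoc, ha.2, mul_assoc, hx, ← mul_assoc, ha.2]
  · rw [sub_mul, mul_assoc, hm _ (ha.mul hm'), mul_assoc, mul_assoc, hm _ hm', sub_self]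
  · rw [mul_sub, ← mul_assoc, ← ht _ ht', ← mul_assoc, ← ht _ (ht'.mul ha), mul_assoc, sub_self]

theorem isCent_of_commute (h : FaithfulPair e f) {x : A} (hx : x * e = e * x)
    (hm : ∀ m, IsBlock e f m → x * m = m * x) (ht : ∀ t, IsBlock f e t → x * t = t * x) :
    IsCent x := fun y => by
  rw [h.eq_add_blocks y]
  simp only [mul_add, add_mul]
  rw [h.mul_comm_left_corner hx hm ht (h.isBlock_left y), hm _ (h.isBlock_left_right y),
    ht _ (h.symm.isBlock_left_right y),
    h.symm.mul_comm_left_corner (h.commute_right hx) ht hm (h.symm.isBlock_left y)]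

theorem eq_zero_of_isCent (h : FaithfulPair e f) {z : A} (hz : IsCent z) (h0 : f * z * f = 0) :
    z = 0 := by
  have hb := h.isBlock_of_commute (hz e) h0
  refine h.faithful_left z hb (fun m hm => ?_) fun t ht => ?_
  · rw [hz, hm.mul_eq_zero h.right_left hb]
  · rw [← hz, hb.mul_eq_zero h.left_right ht]

theorem isBlock_of_eigen (h : FaithfulPair e f) (h2 : TorsionFreeAt A 2) {u v : A} {N : ℕ}
    (hv : IsBlock e f v) (hu : -u = u * e - e * u + N • v) : IsBlock e f u ∧ N • v = 0 := by
  have hve : v * e = 0 := hv.mul_eq_zero h.right_left ⟨h.left, h.left⟩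
  have hfv : f * v = 0 :=
    IsBlock.mul_eq_zero (p := f) (q := f) ⟨h.right, h.right⟩ h.right_left hv
  have key : ∀ p q : A, p * (-u) * q = p * (u * e - e * u + N • v) * q := fun p q => by rw [hu]
  have hl : ∀ z, e * (e * z) = e * z := fun z => by rw [← mul_assoc, h.left]
  have hr : ∀ z, f * (e * z) = 0 := fun z => by rw [← mul_assoc, h.right_left, zero_mul]
  have hee : e * u * e = 0 := by
    have := key e e
    simp only [mul_add, add_mul, mul_sub, sub_mul, mul_assoc, h.left, hl, mul_smul_comm,
      smul_mul_assoc, hve, mul_zero, smul_zero, mul_neg, neg_mul, sub_self, add_zero,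
      neg_eq_zero] at this
    rw [mul_assoc, this]
  have hff : f * u * f = 0 := by
    have := key f f
    simp only [mul_add, mul_sub, mul_assoc, h.left_right, hr, mul_smul_comm,
      hfv, mul_zero, smul_zero, mul_neg, neg_mul, sub_zero, add_zero,
      neg_eq_zero] at this
    rw [mul_assoc, this]
  have hfe : f * u * e = 0 := by
    have := key f e
    simp only [mul_add, add_mul, mul_sub, mul_assoc, h.left, hr, mul_smul_comm,
      smul_mul_assoc, hve, mul_zero, smul_zero, mul_neg, neg_mul, sub_zero, add_zero] at this
    refine h2 _ ?_
    rw [two_nsmul, mul_assoc]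
    nth_rw 1 [← this]
    exact neg_add_cancel _
  have hef : N • v = 0 := by
    have := key e f
    simp only [mul_add, add_mul, mul_sub, sub_mul, mul_assoc, h.left_right, hl, mul_smul_comm,
      smul_mul_assoc, hv.2, hv.1, mul_zero, mul_neg, neg_mul, zero_sub] at this
    simpa using this
  refine ⟨?_, hef⟩
  rw [h.eq_add_blocks u, hee, hff, hfe, zero_add, add_zero, add_zero]
  exact h.isBlock_left_right u

end FaithfulPair

theorem exists_linearMap_isCent {R : Type*} [CommRing R] [Algebra R A] {g : A} (L : A →ₗ[R] A)
    (hg : ∀ z, IsCent z → g * z * g = 0 → z = 0)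
    (hL : ∀ a, ∃ z, IsCent z ∧ g * L a * g = g * z * g) :
    ∃ γ : A →ₗ[R] A, ∀ a, IsCent (γ a) ∧ g * L a * g = g * γ a * g := by
  choose γ hc hγ using hL
  refine ⟨⟨⟨γ, fun a b => ?_⟩, fun r a => ?_⟩, fun a => ⟨hc a, hγ a⟩⟩
  · refine sub_eq_zero.1 (hg _ (fun y => ?_) ?_)
    · simp only [mul_add, add_mul, mul_sub, sub_mul, hc _ y]
    · rw [mul_sub, sub_mul, ← hγ, mul_add, add_mul, ← hγ, ← hγ, map_add, mul_add, add_mul,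
        sub_self]
  · refine sub_eq_zero.1 (hg _ (fun y => ?_) ?_)
    · simp only [mul_sub, sub_mul, RingHom.id_apply, smul_mul_assoc, mul_smul_comm, hc _ y]
    · rw [mul_sub, sub_mul, ← hγ, map_smul, RingHom.id_apply, mul_smul_comm, smul_mul_assoc,
        mul_smul_comm, smul_mul_assoc, ← hγ, sub_self]

end Peirce

section BlockDerivation

variable {R A : Type*} [CommRing R] [Ring A] [Algebra R A] {e f : A}

theorem FaithfulPair.leibniz_of_bracket (h : FaithfulPair e f) {d : A →ₗ[R] A}
    (hee : ∀ x, IsBlock e e x → IsBlock e e (d x)) (hff : ∀ x, IsBlock f f x → IsBlock f f (d x))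
    (hef : ∀ x, IsBlock e f x → IsBlock e f (d x)) (hfe : ∀ x, IsBlock f e x → IsBlock f e (d x))
    (ham : ∀ a m, IsBlock e e a → IsBlock e f m →
      d (a * m - m * a) = d a * m - m * d a + (a * d m - d m * a))
    (hat : ∀ a t, IsBlock e e a → IsBlock f e t →
      d (a * t - t * a) = d a * t - t * d a + (a * d t - d t * a))
    (hmt : ∀ m t, IsBlock e f m → IsBlock f e t →
      d (m * t - t * m) = d m * t - t * d m + (m * d t - d t * m)) :
    (∀ a m, IsBlock e e a → IsBlock e f m → d (a * m) = d a * m + a * d m) ∧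
    (∀ t a, IsBlock f e t → IsBlock e e a → d (t * a) = d t * a + t * d a) ∧
    (∀ m t, IsBlock e f m → IsBlock f e t → d (m * t) = d m * t + m * d t) ∧
    (∀ a b, IsBlock e e a → IsBlock e e b → d (a * b) = d a * b + a * d b) := by
  have left : ∀ a m, IsBlock e e a → IsBlock e f m → d (a * m) = d a * m + a * d m := by
    intro a m ha hm
    have := ham a m ha hm
    rwa [hm.mul_eq_zero h.right_left ha, hm.mul_eq_zero h.right_left (hee a ha),
      (hef m hm).mul_eq_zero h.right_left ha, sub_zero, sub_zero, sub_zero] at this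
  have right : ∀ t a, IsBlock f e t → IsBlock e e a → d (t * a) = d t * a + t * d a := by
    intro t a ht ha
    have := hat a t ha ht
    rw [ha.mul_eq_zero h.left_right ht, (hee a ha).mul_eq_zero h.left_right ht,
      ha.mul_eq_zero h.left_right (hfe t ht), zero_sub, zero_sub, zero_sub, map_neg] at this
    rw [← neg_inj, this]; abel
  refine ⟨left, right, fun m t hm ht => ?_, fun a b ha hb => ?_⟩
  · have hp : IsBlock e e (d (m * t) - (d m * t + m * d t)) :=
      (hee _ (hm.mul ht)).sub (((hef m hm).mul ht).add (hm.mul (hfe t ht)))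
    have hq : IsBlock f f (d (t * m) - (d t * m + t * d m)) :=
      (hff _ (ht.mul hm)).sub (((hfe t ht).mul hm).add (ht.mul (hef m hm)))
    have heq : d (m * t) - (d m * t + m * d t) = d (t * m) - (d t * m + t * d m) := by
      have := hmt m t hm ht
      rw [map_sub, sub_eq_iff_eq_add] at this
      rw [this]; abel
    refine sub_eq_zero.1 ?_
    rw [← hp.1, heq]
    exact IsBlock.mul_eq_zero (p := e) (q := e) ⟨h.left, h.left⟩ h.left_right hq
  · have hab := (hee _ (ha.mul hb)).sub (((hee a ha).mul hb).add (ha.mul (hee b hb)))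
    refine sub_eq_zero.1 (h.faithful_left _ hab (fun m hm => ?_) fun t ht => ?_)
    · have h1 := left (a * b) m (ha.mul hb) hm
      rw [mul_assoc, left a (b * m) ha (hb.mul hm), left b m hb hm] at h1
      rw [sub_mul, ← add_sub_cancel_right (d (a * b) * m) (a * b * d m), ← h1]
      noncomm_ring
    · have h1 := right t (a * b) ht (ha.mul hb)
      rw [← mul_assoc, right (t * a) b (ht.mul ha) hb, right t a ht ha] at h1
      rw [mul_sub, ← add_sub_cancel_left (d t * (a * b)) (t * d (a * b)), ← h1]
      noncomm_ring

theorem FaithfulPair.isDeriv_of_blocks (h : FaithfulPair e f) {d : A →ₗ[R] A}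
    (hd : ∀ p q r s : A, p = e ∨ p = f → q = e ∨ q = f → r = e ∨ r = f → s = e ∨ s = f →
      ∀ x y, IsBlock p q x → IsBlock r s y → d (x * y) = d x * y + x * d y) :
    IsDeriv d := by
  have hright : ∀ p q : A, p = e ∨ p = f → q = e ∨ q = f → ∀ x y, IsBlock p q x →
      d (x * y) = d x * y + x * d y := by
    intro p q hp hq x y hx
    have h1 := hd p q e e hp hq (.inl rfl) (.inl rfl) x _ hx (h.isBlock_left y)
    have h2 := hd p q e f hp hq (.inl rfl) (.inr rfl) x _ hx (h.isBlock_left_right y)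
    have h3 := hd p q f e hp hq (.inr rfl) (.inl rfl) x _ hx (h.symm.isBlock_left_right y)
    have h4 := hd p q f f hp hq (.inr rfl) (.inr rfl) x _ hx (h.symm.isBlock_left y)
    rw [h.eq_add_blocks y]
    simp only [mul_add, map_add, h1, h2, h3, h4]
    abel
  intro x y
  have h1 := hright e e (.inl rfl) (.inl rfl) _ y (h.isBlock_left x)
  have h2 := hright e f (.inl rfl) (.inr rfl) _ y (h.isBlock_left_right x)
  have h3 := hright f e (.inr rfl) (.inl rfl) _ y (h.symm.isBlock_left_right x)
  have h4 := hright f f (.inr rfl) (.inr rfl) _ y (h.symm.isBlock_left x)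
  rw [h.eq_add_blocks x]
  simp only [add_mul, map_add, h1, h2, h3, h4]
  abel

theorem FaithfulPair.isDeriv_of_bracket (h : FaithfulPair e f) {d : A →ₗ[R] A}
    (hd : ∀ p q : A, p = e ∨ p = f → q = e ∨ q = f → ∀ x, IsBlock p q x → IsBlock p q (d x))
    (hdiag : ∀ x y, IsBlock e e x ∨ IsBlock f f x → IsBlock e f y ∨ IsBlock f e y →
      d (x * y - y * x) = d x * y - y * d x + (x * d y - d y * x))
    (hoff : ∀ m t, IsBlock e f m → IsBlock f e t →
      d (m * t - t * m) = d m * t - t * d m + (m * d t - d t * m)) :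
    IsDeriv d := by
  have hee := hd e e (.inl rfl) (.inl rfl)
  have hef := hd e f (.inl rfl) (.inr rfl)
  have hfe := hd f e (.inr rfl) (.inl rfl)
  have hff := hd f f (.inr rfl) (.inr rfl)
  obtain ⟨eef, fee, efe, eee⟩ := h.leibniz_of_bracket hee hff hef hfe
    (fun a m ha hm => hdiag a m (.inl ha) (.inl hm))
    (fun a t ha ht => hdiag a t (.inl ha) (.inr ht)) hoff
  obtain ⟨ffe, eff, fef, fff⟩ := h.symm.leibniz_of_bracket hff hee hfe hef
    (fun b t hb ht => hdiag b t (.inr hb) (.inr ht))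
    (fun b m hb hm => hdiag b m (.inr hb) (.inl hm)) (fun t m ht hm => by
      rw [← neg_inj, ← map_neg, neg_sub, hoff m t hm ht]; abel)
  refine h.isDeriv_of_blocks fun p q r s hp hq hr hs x y hx hy => ?_
  have hzero : q * r = 0 → d (x * y) = d x * y + x * d y := fun hqr => by
    rw [hx.mul_eq_zero hqr hy, (hd p q hp hq x hx).mul_eq_zero hqr hy,
      hx.mul_eq_zero hqr (hd r s hr hs y hy), map_zero, add_zero]
  rcases hq with rfl | rfl <;> rcases hr with rfl | rfl
  · rcases hp with rfl | rfl <;> rcases hs with rfl | rfl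
    exacts [eee x y hx hy, eef x y hx hy, fee x y hx hy, fef x y hx hy]
  · exact hzero h.left_right
  · exact hzero h.right_left
  · rcases hp with rfl | rfl <;> rcases hs with rfl | rfl
    exacts [efe x y hx hy, eff x y hx hy, ffe x y hx hy, fff x y hx hy]

end BlockDerivation

section LieDerivation

variable {R A : Type*} [CommRing R] [Ring A] [Algebra R A]

theorem isLieNDeriv_iff {k : ℕ} {φ : A →ₗ[R] A} :
    IsLieNDeriv (k + 1) φ ↔ ∀ x, φ (pCom x k) = leibSum φ x k :=
  forall_congr' fun x => by rw [Nat.add_sub_cancel, sum_pCom_update]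

theorem IsDeriv.bracket {d : A →ₗ[R] A} (hd : IsDeriv d) (x y : A) :
    d (x * y - y * x) = d x * y - y * d x + (x * d y - d y * x) := by
  rw [map_sub, hd, hd]; abel

theorem IsDeriv.map_pCom {d : A →ₗ[R] A} (hd : IsDeriv d) (x : ℕ → A) (k : ℕ) :
    d (pCom x k) = leibSum d x k := by
  induction k with
  | zero => rfl
  | succ k ih => rw [pCom, hd.bracket, ih, leibSum]

theorem isDeriv_inner (c : A) :
    IsDeriv (LinearMap.mulRight R c - LinearMap.mulLeft R c) := fun x y => by
  simp only [LinearMap.sub_apply, LinearMap.mulRight_apply, LinearMap.mulLeft_apply]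
  noncomm_ring

theorem IsLieNDeriv.sub_isDeriv {k : ℕ} {φ d : A →ₗ[R] A} (hφ : IsLieNDeriv (k + 1) φ)
    (hd : IsDeriv d) : IsLieNDeriv (k + 1) (φ - d) :=
  isLieNDeriv_iff.2 fun x => by
    rw [LinearMap.sub_apply, isLieNDeriv_iff.1 hφ, hd.map_pCom, ← leibSum_sub]
    rfl

/-- A Lie `n`-derivation that differs from a derivation by a central-valued map is standard. -/
theorem IsLieNDeriv.isStandard {k : ℕ} {φ d : A →ₗ[R] A} (hφ : IsLieNDeriv (k + 2) φ)
    (hd : IsDeriv d) (hc : ∀ a, IsCent ((φ - d) a)) : IsStandardLieNDeriv (k + 2) φ :=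
  ⟨d, φ - d, hd, hc, fun x => (isLieNDeriv_iff.1 (hφ.sub_isDeriv hd) x).trans
    (leibSum_eq_zero_of_isCent hc x k), (add_sub_cancel d φ).symm⟩

variable {e f : A} {j : ℕ} {ψ : A →ₗ[R] A}

theorem FaithfulPair.eigen_of_isLieNDeriv (h : FaithfulPair e f) (hψ : IsLieNDeriv (2 * j + 2) ψ)
    (hc : ψ e * e = e * ψ e) {y : A} (hy : IsBlock e f y ∨ IsBlock f e y) :
    ψ (y * e - e * y) = ψ y * e - e * ψ y + (2 * j + 1) • (y * ψ e - ψ e * y) := by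
  have hy' := h.bracket_bracket hy
  have := isLieNDeriv_iff.1 hψ (fun i => if i = 0 then y else e)
  rwa [pCom_idempotent_odd hy', leibSum_idempotent_odd h.left hc hy'] at this

theorem FaithfulPair.map_left_right (h : FaithfulPair e f) (h2 : TorsionFreeAt A 2)
    (hj : TorsionFreeAt A (2 * j + 1)) (hψ : IsLieNDeriv (2 * j + 2) ψ)
    (hc : ψ e * e = e * ψ e) {m : A} (hm : IsBlock e f m) :
    IsBlock e f (ψ m) ∧ ψ e * m = m * ψ e := by
  have hme : m * e = 0 := hm.mul_eq_zero h.right_left ⟨h.left, h.left⟩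
  have hv : IsBlock e f (m * ψ e - ψ e * m) := IsBlock.sub
    ⟨by rw [← mul_assoc, hm.1], by rw [mul_assoc, h.commute_right hc, ← mul_assoc, hm.2]⟩
    ⟨by rw [← mul_assoc, ← hc, mul_assoc, hm.1], by rw [mul_assoc, hm.2]⟩
  have := h.eigen_of_isLieNDeriv hψ hc (.inl hm)
  rw [hme, hm.1, zero_sub, map_neg] at this
  obtain ⟨h3, h4⟩ := h.isBlock_of_eigen h2 hv this
  exact ⟨h3, (sub_eq_zero.1 (hj _ h4)).symm⟩

theorem FaithfulPair.map_right_left (h : FaithfulPair e f) (h2 : TorsionFreeAt A 2)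
    (hj : TorsionFreeAt A (2 * j + 1)) (hψ : IsLieNDeriv (2 * j + 2) ψ)
    (hc : ψ e * e = e * ψ e) {t : A} (ht : IsBlock f e t) :
    IsBlock f e (ψ t) ∧ ψ e * t = t * ψ e := by
  have het : e * t = 0 := IsBlock.mul_eq_zero (p := e) (q := e) ⟨h.left, h.left⟩ h.left_right ht
  have hv : IsBlock f e (ψ e * t - t * ψ e) := IsBlock.sub
    ⟨by rw [← mul_assoc, ← h.commute_right hc, mul_assoc, ht.1], by rw [mul_assoc, ht.2]⟩
    ⟨by rw [← mul_assoc, ht.1], by rw [mul_assoc, hc, ← mul_assoc, ht.2]⟩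
  have := h.eigen_of_isLieNDeriv hψ hc (.inr ht)
  rw [het, ht.2, sub_zero] at this
  have h5 : -ψ t = ψ t * f - f * ψ t + (2 * j + 1) • (ψ e * t - t * ψ e) := by
    rw [← neg_sub (t * ψ e), smul_neg, h.right_eq]
    nth_rw 1 [this]
    noncomm_ring
  obtain ⟨h3, h4⟩ := h.symm.isBlock_of_eigen h2 hv h5
  exact ⟨h3, sub_eq_zero.1 (hj _ h4)⟩

theorem FaithfulPair.isCent_map_left (h : FaithfulPair e f) (h2 : TorsionFreeAt A 2)
    (hj : TorsionFreeAt A (2 * j + 1)) (hψ : IsLieNDeriv (2 * j + 2) ψ)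
    (hc : ψ e * e = e * ψ e) : IsCent (ψ e) :=
  h.isCent_of_commute hc (fun _ hm => (h.map_left_right h2 hj hψ hc hm).2)
    fun _ ht => (h.map_right_left h2 hj hψ hc ht).2

theorem IsLieNDeriv.map_bracket (hψ : IsLieNDeriv (2 * j + 2) ψ) (hc : IsCent (ψ e)) {y w : A}
    (hp : ((y * w - w * y) * e - e * (y * w - w * y)) * e -
      e * ((y * w - w * y) * e - e * (y * w - w * y)) = y * w - w * y)
    {g : A} (hg : ψ y * w - w * ψ y + (y * ψ w - ψ w * y) = g)
    (hl : (g * e - e * g) * e - e * (g * e - e * g) = g) :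
    ψ (y * w - w * y) = g := by
  let x : ℕ → A := fun i => if i = 0 then y else if i = 1 then w else e
  have hx : ∀ i, 1 < i → i ≤ 1 + 2 * j → x i = e := fun i hi _ => by
    simp [x, show i ≠ 0 by omega, show i ≠ 1 by omega]
  have hp1 : pCom x 1 = y * w - w * y := rfl
  have hl1 : leibSum ψ x 1 = g := hg
  have := isLieNDeriv_iff.1 hψ x
  rwa [add_comm (2 * j), pCom_add_two_mul hx (by rw [hp1, hp]),
    leibSum_add_two_mul hc hx (by rw [hl1, hl]), hp1, hl1] at this

theorem FaithfulPair.exists_pCom_eq_bracket (h : FaithfulPair e f) (j : ℕ) {m : A}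
    (hm : IsBlock e f m) (t : A) : ∃ x : ℕ → A, (∀ i, 0 < i → i ≤ 0 + 2 * j → x i = e) ∧ x 0 = m ∧
      x (2 * j + 1) = t ∧ pCom x (2 * j + 1) = m * t - t * m := by
  let x : ℕ → A := fun i => if i = 0 then m else if i = 2 * j + 1 then t else e
  have hx : ∀ i, 0 < i → i ≤ 0 + 2 * j → x i = e := fun i hi _ => by
    simp [x, show i ≠ 0 by omega, show i ≠ 2 * j + 1 by omega]
  have hp := pCom_add_two_mul hx (h.bracket_bracket (.inl hm))
  rw [zero_add, show pCom x 0 = m from rfl] at hp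
  have ht : x (2 * j + 1) = t := by simp [x]
  exact ⟨x, hx, rfl, ht, by rw [pCom, hp, ht]⟩

theorem FaithfulPair.map_bracket_offDiag (h : FaithfulPair e f) (hψ : IsLieNDeriv (2 * j + 2) ψ)
    (hc : IsCent (ψ e)) {m : A} (hm : IsBlock e f m) (hψm : IsBlock e f (ψ m)) (t : A) :
    ψ (m * t - t * m) = ψ m * t - t * ψ m + (m * ψ t - ψ t * m) := by
  obtain ⟨x, hx, h0, ht, hxp⟩ := h.exists_pCom_eq_bracket j hm t
  have hp := pCom_add_two_mul (s := 0) hx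
    (h.bracket_bracket (.inl (show IsBlock e f (pCom x 0) by rwa [pCom, h0])))
  have hl := leibSum_add_two_mul hc (s := 0) hx
    (h.bracket_bracket (.inl (show IsBlock e f (leibSum ψ x 0) by rwa [leibSum, h0])))
  rw [zero_add] at hp hl
  have := isLieNDeriv_iff.1 hψ x
  rw [hxp, leibSum, hp, hl, ht] at this
  rw [this, pCom, leibSum, h0]

theorem FaithfulPair.map_commute (h : FaithfulPair e f) (hψ : IsLieNDeriv (2 * j + 2) ψ)
    (hc : IsCent (ψ e)) {a : A} (ha : a * e = e * a) : ψ a * e = e * ψ a := by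
  have h1 : ∀ z, e * (e * z) = e * z := fun z => by rw [← mul_assoc, h.left]
  have := hψ.map_bracket hc (y := a) (w := e) (by simp [ha]) rfl (by
    rw [hc, sub_self, add_zero]
    simp only [mul_sub, sub_mul, mul_assoc, h.left, h1]
    abel)
  rw [ha, hc, sub_self, sub_self, add_zero, map_zero] at this
  exact (sub_eq_zero.1 this.symm)

theorem FaithfulPair.map_bracket_diag (h : FaithfulPair e f) (hψ : IsLieNDeriv (2 * j + 2) ψ)
    (hc : IsCent (ψ e)) {p q a m : A} (hpq : p = e ∧ q = f ∨ p = f ∧ q = e)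
    (ha : a * p = p * a) (hψa : ψ a * p = p * ψ a)
    (haq : a * q = q * a) (hψaq : ψ a * q = q * ψ a)
    (hm : IsBlock p q m) (hψm : IsBlock p q (ψ m)) :
    ψ (a * m - m * a) = ψ a * m - m * ψ a + (a * ψ m - ψ m * a) := by
  have key : ∀ {b n : A}, b * p = p * b → b * q = q * b → IsBlock p q n →
      IsBlock p q (b * n - n * b) := fun hp hq hn => IsBlock.sub
    ⟨by rw [← mul_assoc, ← hp, mul_assoc, hn.1], by rw [mul_assoc, hn.2]⟩
    ⟨by rw [← mul_assoc, hn.1], by rw [mul_assoc, hq, ← mul_assoc, hn.2]⟩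
  have hD : ∀ {u : A}, IsBlock p q u → (u * e - e * u) * e - e * (u * e - e * u) = u := by
    intro u hu
    rcases hpq with ⟨rfl, rfl⟩ | ⟨rfl, rfl⟩
    exacts [h.bracket_bracket (.inl hu), h.bracket_bracket (.inr hu)]
  exact hψ.map_bracket hc (hD (key ha haq hm)) rfl
    (hD ((key hψa hψaq hm).add (key ha haq hψm)))

/-- The sufficiency direction for a Lie derivation already normalized so that `ψ e` is
block-diagonal. -/
theorem FaithfulPair.isStandard_of_commute (h : FaithfulPair e f) (h2 : TorsionFreeAt A 2)
    (hj : TorsionFreeAt A (2 * j + 1)) (hψ : IsLieNDeriv (2 * j + 2) ψ)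
    (hc : ψ e * e = e * ψ e)
    (hA : ∀ a, ∃ z, IsCent z ∧ f * ψ (e * a * e) * f = f * z * f)
    (hB : ∀ b, ∃ z, IsCent z ∧ e * ψ (f * b * f) * e = e * z * e)
    (hC : ∀ m t, IsBlock e f m → IsBlock f e t →
      IsCent (e * ψ (t * m) * e + f * ψ (m * t) * f)) :
    IsStandardLieNDeriv (2 * j + 2) ψ := by
  obtain ⟨α, hα⟩ := exists_linearMap_isCent (ψ ∘ₗ LinearMap.mulLeftRight R (e, e))
    (fun z hz h0 => h.eq_zero_of_isCent hz h0) (by simpa using hA)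
  obtain ⟨β, hβ⟩ := exists_linearMap_isCent (ψ ∘ₗ LinearMap.mulLeftRight R (f, f))
    (fun z hz h0 => h.symm.eq_zero_of_isCent hz h0) (by simpa using hB)
  simp only [LinearMap.comp_apply, LinearMap.mulLeftRight_apply] at hα hβ
  have hα0 : ∀ x, e * x * e = 0 → α x = 0 := fun x hx =>
    h.eq_zero_of_isCent (hα x).1 (by rw [← (hα x).2, hx]; simp)
  have hβ0 : ∀ x, f * x * f = 0 → β x = 0 := fun x hx =>
    h.symm.eq_zero_of_isCent (hβ x).1 (by rw [← (hβ x).2, hx]; simp)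
  have he : IsBlock e e e := ⟨h.left, h.left⟩
  have hf : IsBlock f f f := ⟨h.right, h.right⟩
  have hcent := h.isCent_map_left h2 hj hψ hc
  have hψm := fun m (hm : IsBlock e f m) => (h.map_left_right h2 hj hψ hc hm).1
  have hψt := fun t (ht : IsBlock f e t) => (h.map_right_left h2 hj hψ hc ht).1
  have hαb : ∀ x, IsBlock f f x → α x = 0 := fun x hx =>
    hα0 x (by rw [he.mul_eq_zero h.left_right hx, zero_mul])
  have hβa : ∀ x, IsBlock e e x → β x = 0 := fun x hx =>
    hβ0 x (by rw [hf.mul_eq_zero h.right_left hx, zero_mul])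
  have hγm : ∀ x, IsBlock e f x ∨ IsBlock f e x → α x = 0 ∧ β x = 0 := by
    rintro x (hx | hx)
    · exact ⟨hα0 x (by rw [mul_assoc, hx.mul_eq_zero h.right_left he, mul_zero]),
        hβ0 x (by rw [hf.mul_eq_zero h.right_left hx, zero_mul])⟩
    · exact ⟨hα0 x (by rw [he.mul_eq_zero h.left_right hx, zero_mul]),
        hβ0 x (by rw [mul_assoc, hx.mul_eq_zero h.left_right hf, mul_zero])⟩
  have hcomm : ∀ x, IsBlock e e x ∨ IsBlock f f x → x * e = e * x := by
    rintro x (hx | hx)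
    · rw [hx.1, hx.2]
    · rw [hx.mul_eq_zero h.right_left he, he.mul_eq_zero h.left_right hx]
  have hψcomm := fun x hx => h.map_commute hψ hcent (hcomm x hx)
  have hd : ∀ x, (ψ - (α + β)) x = ψ x - (α x + β x) := fun x => rfl
  have hdm : ∀ x, IsBlock e f x ∨ IsBlock f e x → (ψ - (α + β)) x = ψ x := fun x hx => by
    rw [hd, (hγm x hx).1, (hγm x hx).2, add_zero, sub_zero]
  have hγ : ∀ x, IsCent (α x + β x) := fun x y => by
    rw [add_mul, mul_add, (hα x).1, (hβ x).1]
  have hbr : ∀ x y, (ψ - (α + β)) x * y - y * (ψ - (α + β)) x +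
      (x * (ψ - (α + β)) y - (ψ - (α + β)) y * x) =
      ψ x * y - y * ψ x + (x * ψ y - ψ y * x) := fun x y => by
    rw [hd, hd, sub_mul, mul_sub, sub_mul, mul_sub, hγ x y, hγ y x]
    abel
  refine hψ.isStandard (d := ψ - (α + β)) (h.isDeriv_of_bracket ?_ ?_ ?_) fun a => by
    rw [sub_sub_cancel]; exact hγ a
  · rintro p q (rfl | rfl) (rfl | rfl) x hx
    · refine h.isBlock_of_commute ?_ ?_
      · rw [hd, sub_mul, mul_sub, hγ, hψcomm x (.inl hx)]
      · have := (hα x).2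
        rw [hx.1, hx.2] at this
        rw [hd, hβa x hx, add_zero, mul_sub, sub_mul, this, sub_self]
    · rw [hdm x (.inl hx)]; exact hψm x hx
    · rw [hdm x (.inr hx)]; exact hψt x hx
    · refine h.symm.isBlock_of_commute ?_ ?_
      · rw [hd, sub_mul, mul_sub, hγ, h.commute_right (hψcomm x (.inr hx))]
      · have := (hβ x).2
        rw [hx.1, hx.2] at this
        rw [hd, hαb x hx, zero_add, mul_sub, sub_mul, this, sub_self]
  · intro x y hx hy
    have hxe := hcomm x hx
    have hψe := hψcomm x hx
    have hxf := h.commute_right hxe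
    have hψf := h.commute_right hψe
    rw [hbr]
    rcases hy with hy | hy
    · have hb : IsBlock e f (x * y - y * x) := IsBlock.sub
        ⟨by rw [← mul_assoc, ← hxe, mul_assoc, hy.1], by rw [mul_assoc, hy.2]⟩
        ⟨by rw [← mul_assoc, hy.1], by rw [mul_assoc, hxf, ← mul_assoc, hy.2]⟩
      rw [hdm _ (.inl hb), h.map_bracket_diag hψ hcent (.inl ⟨rfl, rfl⟩) hxe hψe hxf hψf hy
        (hψm y hy)]
    · have hb : IsBlock f e (x * y - y * x) := IsBlock.sub
        ⟨by rw [← mul_assoc, ← hxf, mul_assoc, hy.1], by rw [mul_assoc, hy.2]⟩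
        ⟨by rw [← mul_assoc, hy.1], by rw [mul_assoc, hxe, ← mul_assoc, hy.2]⟩
      rw [hdm _ (.inr hb), h.map_bracket_diag hψ hcent (.inr ⟨rfl, rfl⟩) hxf hψf hxe hψe hy
        (hψt y hy)]
  · intro m t hm ht
    have hmt := hm.mul ht
    have htm := ht.mul hm
    have hαmt := (hα (m * t)).2
    rw [hmt.1, hmt.2] at hαmt
    have hβtm := (hβ (t * m)).2
    rw [htm.1, htm.2] at hβtm
    have hw : IsCent (e * (β (t * m) - α (m * t)) * e) := by
      have hz := hC m t hm ht
      rw [hαmt, hβtm] at hz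
      have h1 : f * α (m * t) * f = α (m * t) - e * α (m * t) * e := by
        rw [mul_assoc, (hα _).1, ← mul_assoc, h.right, mul_assoc, (hα _).1, ← mul_assoc, h.left,
          h.right_eq, sub_mul, one_mul]
      have h3 : e * (β (t * m) - α (m * t)) * e =
          e * β (t * m) * e + f * α (m * t) * f - α (m * t) := by
        rw [h1, mul_sub, sub_mul]; abel
      intro y
      rw [h3, sub_mul, mul_sub, hz y, (hα _).1 y]
    have h0 : e * (β (t * m) - α (m * t)) * e = 0 := h.eq_zero_of_isCent hw (by
      rw [← mul_assoc, ← mul_assoc, h.right_left]; simp)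
    have heq : β (t * m) - α (m * t) = 0 := h.symm.eq_zero_of_isCent (fun y => by
      rw [sub_mul, mul_sub, (hα _).1, (hβ _).1]) h0
    rw [hbr, hd, map_sub α, map_sub β, hαb _ htm, hβa _ hmt, sub_eq_zero.1 heq,
      h.map_bracket_offDiag hψ hcent hm (hψm m hm) t]
    abel

theorem FaithfulPair.isDeriv_corner (h : FaithfulPair e f) {d : A →ₗ[R] A} (hd : IsDeriv d)
    {a : A} (ha : IsBlock e e a) : f * d a * f = 0 := by
  have hfa : f * a = 0 := IsBlock.mul_eq_zero (p := f) (q := f) ⟨h.right, h.right⟩ h.right_left ha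
  rw [← ha.2, hd, mul_add, ← mul_assoc, ← mul_assoc, hfa, zero_mul, add_zero, mul_assoc,
    h.left_right, mul_zero]

/-- Adding a derivation does not change the corner condition. -/
theorem FaithfulPair.add_isDeriv_corner (h : FaithfulPair e f) {φ d : A →ₗ[R] A}
    (hd : IsDeriv d) {a : A} (ha : IsBlock e e a) : f * (φ - d) a * f = f * φ a * f := by
  rw [LinearMap.sub_apply, mul_sub, sub_mul, h.isDeriv_corner hd ha, sub_zero]

theorem FaithfulPair.isStandard_of_corner (h : FaithfulPair e f) (h2 : TorsionFreeAt A 2)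
    (hj : TorsionFreeAt A (2 * j + 1)) {φ : A →ₗ[R] A} (hφ : IsLieNDeriv (2 * j + 2) φ)
    (hA : ∀ a, ∃ z, IsCent z ∧ f * φ (e * a * e) * f = f * z * f)
    (hB : ∀ b, ∃ z, IsCent z ∧ e * φ (f * b * f) * e = e * z * e)
    (hC : ∀ m t, IsBlock e f m → IsBlock f e t →
      IsCent (e * φ (t * m) * e + f * φ (m * t) * f)) :
    IsStandardLieNDeriv (2 * j + 2) φ := by
  let d : A →ₗ[R] A := LinearMap.mulRight R (e * φ e * f - f * φ e * e) -
    LinearMap.mulLeft R (e * φ e * f - f * φ e * e)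
  have hd : IsDeriv d := isDeriv_inner _
  have hc : (φ - d) e * e = e * (φ - d) e := by
    have hl : ∀ z, e * (e * z) = e * z := fun z => by rw [← mul_assoc, h.left]
    have hr : ∀ z, e * (f * z) = 0 := fun z => by rw [← mul_assoc, h.left_right, zero_mul]
    simp only [d, LinearMap.sub_apply, LinearMap.mulRight_apply, LinearMap.mulLeft_apply,
      mul_sub, sub_mul, mul_assoc, hl, hr, h.left, h.right_left, mul_zero, sub_zero, zero_sub]
    rw [h.right_eq]
    simp only [mul_sub, sub_mul, mul_one, one_mul, mul_neg, neg_mul, mul_assoc, hl, h.left]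
    abel
  obtain ⟨δ, γ, hδ, hγ, hγ0, heq⟩ := h.isStandard_of_commute h2 hj (hφ.sub_isDeriv hd) hc
    (fun a => by rw [h.add_isDeriv_corner hd (h.isBlock_left a)]; exact hA a)
    (fun b => by rw [h.symm.add_isDeriv_corner hd (h.symm.isBlock_left b)]; exact hB b)
    fun m t hm ht => by
      rw [h.add_isDeriv_corner hd (hm.mul ht), h.symm.add_isDeriv_corner hd (ht.mul hm)]
      exact hC m t hm ht
  refine ⟨d + δ, γ, fun x y => ?_, hγ, hγ0, ?_⟩
  · simp only [LinearMap.add_apply, hd x y, hδ x y]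
    noncomm_ring
  · rw [add_assoc, ← heq, add_sub_cancel]

theorem FaithfulPair.corner_of_isStandard (h : FaithfulPair e f) {φ : A →ₗ[R] A}
    (hφ : IsStandardLieNDeriv (2 * j + 2) φ) :
    (∀ a, ∃ z, IsCent z ∧ f * φ (e * a * e) * f = f * z * f) ∧
    (∀ b, ∃ z, IsCent z ∧ e * φ (f * b * f) * e = e * z * e) ∧
    (∀ m t, IsBlock e f m → IsBlock f e t →
      IsCent (e * φ (t * m) * e + f * φ (m * t) * f)) := by
  obtain ⟨d, γ, hd, hγ, hγ0, rfl⟩ := hφ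
  have hA : ∀ a, IsBlock e e a → f * (d + γ) a * f = f * γ a * f := fun a ha => by
    rw [LinearMap.add_apply, mul_add, add_mul, h.isDeriv_corner hd ha, zero_add]
  have hB : ∀ b, IsBlock f f b → e * (d + γ) b * e = e * γ b * e := fun b hb => by
    rw [LinearMap.add_apply, mul_add, add_mul, h.symm.isDeriv_corner hd hb, zero_add]
  refine ⟨fun a => ⟨_, hγ _, hA _ (h.isBlock_left a)⟩,
    fun b => ⟨_, hγ _, hB _ (h.symm.isBlock_left b)⟩, fun m t hm ht => ?_⟩
  obtain ⟨x, -, -, -, hx⟩ := h.exists_pCom_eq_bracket j hm t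
  have h0 := hγ0 x
  rw [show 2 * j + 2 - 1 = 2 * j + 1 by omega, hx, map_sub, sub_eq_zero] at h0
  rw [hA _ (hm.mul ht), hB _ (ht.mul hm), h0, mul_assoc, hγ, ← mul_assoc, h.left, mul_assoc,
    hγ _ f, ← mul_assoc, h.right, ← add_mul, h.add, one_mul]
  exact hγ _

end LieDerivation

theorem stmt_5 (R : Type*) [CommRing R] (A : Type*) [Ring A] [Algebra R A]
    (n : ℕ) (hn : 2 ≤ n) (hev : Even n)
    (h2 : TorsionFreeAt A 2) (hn1 : TorsionFreeAt A (n - 1))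
    (e : A) (he : e * e = e) (he0 : e ≠ 0) (he1 : e ≠ 1) (hQ : PropQ e)
    (φ : A →ₗ[R] A) (hφ : IsLieNDeriv n φ) :
    IsStandardLieNDeriv n φ ↔
      ((∀ a : A, ∃ z : A, IsCent z ∧
          (1 - e) * φ (e * a * e) * (1 - e) = (1 - e) * z * (1 - e)) ∧
       (∀ b : A, ∃ z : A, IsCent z ∧
          e * φ ((1 - e) * b * (1 - e)) * e = e * z * e) ∧
       (∀ m t : A, IsCent
          (e * φ (((1 - e) * t * e) * (e * m * (1 - e))) * e +
           (1 - e) * φ ((e * m * (1 - e)) * ((1 - e) * t * e)) * (1 - e)))) := by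
  have h := FaithfulPair.of_propQ he hQ
  obtain ⟨j, rfl⟩ : ∃ j, n = 2 * j + 2 := by
    obtain ⟨i, rfl⟩ := hev
    exact ⟨i - 1, by omega⟩
  rw [show 2 * j + 2 - 1 = 2 * j + 1 by omega] at hn1
  constructor
  · intro hstd
    obtain ⟨hA, hB, hC⟩ := h.corner_of_isStandard hstd
    exact ⟨hA, hB, fun m t => hC _ _ (h.isBlock_left_right m) (h.symm.isBlock_left_right t)⟩
  · rintro ⟨hA, hB, hC⟩
    refine h.isStandard_of_corner h2 hn1 hφ hA hB fun m t hm ht => ?_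
    have := hC m t
    rwa [hm.1, hm.2, ht.1, ht.2] at this
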